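/- arXiv:1905.12805 — 2 statements merged into one kernel-verified Lean document; each statement's English description precedes it below -/
import Mathlib

section
/- Let K be a field and B₁, …, B_m be n × n matrices over K satisfying Bᵢᵀ = −Bᵢ for all i. Suppose the ranges Wᵢ = range(Bᵢ) ⊆ K^n (images of the associated linear maps x ↦ Bᵢ·x) form an independent family of subspaces (their sum is an internal direct sum). Then rank(B₁ + ⋯ + B_m) = rank(B₁) + ⋯ + rank(B_m). In particular, if moreover W₁ + ⋯ + W_m = K^n, then the matrix B₁ + ⋯ + B_m is invertible. -/
open Matrix

/-- If `ker S ≤ ker A` then `A = H * S` for some matrix `H`. -/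
theorem exists_left_factor {K : Type*} [Field K] {n : ℕ} (S A : Matrix (Fin n) (Fin n) K)
    (h : ∀ x, S *ᵥ x = 0 → A *ᵥ x = 0) : ∃ H : Matrix (Fin n) (Fin n) K, A = H * S := by
  obtain ⟨s, hs⟩ := S.mulVecLin.rangeRestrict.exists_rightInverse_of_surjective
    (LinearMap.range_rangeRestrict _)
  obtain ⟨g, hg⟩ := LinearMap.exists_extend (A.mulVecLin.comp s)
  refine ⟨LinearMap.toMatrix' g, ?_⟩
  apply Matrix.toLin'.injective
  rw [Matrix.toLin'_mul, Matrix.toLin'_toMatrix']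
  refine LinearMap.ext fun x => ?_
  have h1 := LinearMap.congr_fun hg (S.mulVecLin.rangeRestrict x)
  have h2 := congrArg Subtype.val (LinearMap.congr_fun hs (S.mulVecLin.rangeRestrict x))
  simp only [LinearMap.comp_apply, Submodule.subtype_apply,
    LinearMap.codRestrict_apply, LinearMap.id_apply, Matrix.mulVecLin_apply] at h1 h2
  simp only [LinearMap.comp_apply, Matrix.toLin'_apply]
  have h3 := h (x - s (S.mulVecLin.rangeRestrict x)) (by
    rw [Matrix.mulVec_sub, sub_eq_zero]; exact h2.symm)
  rw [Matrix.mulVec_sub, sub_eq_zero] at h3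
  rw [h3]; exact h1.symm

/-- let `K` be a field and `B₁, …, B_m` skew-symmetric `n × n` matrices over `K`
(`Bᵢᵀ = −Bᵢ`) whose ranges form an independent family of subspaces of `K^n`.  Then
`rank (B₁ + ⋯ + B_m) = rank B₁ + ⋯ + rank B_m`; in particular, if the ranges span `K^n`,
the matrix `B₁ + ⋯ + B_m` is invertible. -/
theorem stmt_12 {K : Type*} [Field K] (n m : ℕ)
    (B : Fin m → Matrix (Fin n) (Fin n) K)
    (hskew : ∀ i, (B i)ᵀ = -(B i))
    (hindep : iSupIndep fun i => LinearMap.range (B i).mulVecLin) :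
    (∑ i, B i).rank = ∑ i, (B i).rank ∧
    ((⨆ i, LinearMap.range (B i).mulVecLin) = ⊤ → IsUnit (∑ i, B i)) := by
  set S := ∑ i, B i with hS
  have hST : Sᵀ = -S := by
    rw [hS, Matrix.transpose_sum, ← Finset.sum_neg_distrib]
    exact Finset.sum_congr rfl fun i _ => hskew i
  have hker : ∀ i x, S *ᵥ x = 0 → B i *ᵥ x = 0 := by
    intro i x hx
    rw [hS, Matrix.sum_mulVec] at hx
    exact (iSupIndep_iff_finsetSum_eq_zero_imp_eq_zero _).1 hindep Finset.univ
      (fun i => B i *ᵥ x) (fun j _ => ⟨x, rfl⟩) hx i (Finset.mem_univ i)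
  have hle : ∀ i, LinearMap.range (B i).mulVecLin ≤ LinearMap.range S.mulVecLin := by
    intro i
    obtain ⟨H, hH⟩ := exists_left_factor S (B i) (hker i)
    have h2 : B i = S * Hᵀ := by
      have := congrArg Matrix.transpose hH
      rw [hskew, Matrix.transpose_mul, hST, Matrix.neg_mul] at this
      exact neg_injective this
    rw [h2, Matrix.mulVecLin_mul]
    exact LinearMap.range_comp_le_range _ _
  have hrange : LinearMap.range S.mulVecLin = ⨆ i, LinearMap.range (B i).mulVecLin := by
    refine le_antisymm ?_ (iSup_le hle)
    rintro _ ⟨x, rfl⟩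
    rw [Matrix.mulVecLin_apply, hS, Matrix.sum_mulVec]
    exact Submodule.sum_mem _ fun i _ => Submodule.mem_iSup_of_mem i ⟨x, rfl⟩
  constructor
  · unfold Matrix.rank
    rw [hrange, Submodule.iSup_eq_range_dfinsupp_lsum,
      LinearMap.finrank_range_of_inj hindep.dfinsupp_lsum_injective]
    exact Module.finrank_directSum _ _
  · intro htop
    rw [← Matrix.mulVec_surjective_iff_isUnit]
    rw [← hrange] at htop
    exact LinearMap.range_eq_top.1 htop
end

section
/- Let R be a commutative ring, N ⊆ R an ideal, and f ∈ R such that for every i ≥ 0 and every x ∈ N^i, if f·x ∈ N^{i+1} then x ∈ N^{i+1} (where N⁰ = R). Then for every i ≥ 0, every m ≥ 0, and every a ∈ R: if f^m·a ∈ N^i then a ∈ N^i. In particular, multiplication by f is injective on R/N^i for every i. -/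
/-- let `R` be a commutative ring, `N ⊆ R` an ideal and `f ∈ R` such that for
all `i ≥ 0` and `x ∈ N^i`, `f·x ∈ N^{i+1}` implies `x ∈ N^{i+1}` (i.e. `f` acts injectively
on each graded piece `N^i/N^{i+1}`, with `N⁰ = R`).  Then for all `i, m ≥ 0` and `a ∈ R`,
`f^m · a ∈ N^i` implies `a ∈ N^i`; in particular multiplication by `f` is injective on
`R/N^i` for every `i`. -/
theorem stmt_18 {R : Type*} [CommRing R] (N : Ideal R) (f : R)
    (hreg : ∀ (i : ℕ) (x : R), x ∈ N ^ i → f * x ∈ N ^ (i + 1) → x ∈ N ^ (i + 1)) :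
    (∀ (i m : ℕ) (a : R), f ^ m * a ∈ N ^ i → a ∈ N ^ i) ∧
    (∀ i : ℕ, Function.Injective fun a : R ⧸ (N ^ i : Ideal R) => f • a) := by
  have h1 : ∀ (i : ℕ) (a : R), f * a ∈ N ^ i → a ∈ N ^ i := by
    intro i
    induction i with
    | zero => intro a _; simp
    | succ k ih =>
      intro a ha
      exact hreg k a (ih a (Ideal.pow_le_pow_right (Nat.le_succ k) ha)) ha
  refine ⟨?_, ?_⟩
  · intro i m
    induction m with
    | zero => intro a ha; simpa using ha
    | succ k ih =>
      intro a ha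
      apply h1 i a
      apply ih
      rwa [pow_succ, mul_assoc] at ha
  · intro i x y hxy
    obtain ⟨a, rfl⟩ := Ideal.Quotient.mk_surjective x
    obtain ⟨b, rfl⟩ := Ideal.Quotient.mk_surjective y
    have h2 : Ideal.Quotient.mk (N ^ i) (f * a) = Ideal.Quotient.mk (N ^ i) (f * b) := hxy
    rw [Ideal.Quotient.eq, ← mul_sub] at h2
    exact Ideal.Quotient.eq.mpr (h1 i _ h2)
end
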